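/- Let (P, Q) be an irreducible pair of real quadratic forms on ℝ³ that satisfies the (D) condition and the (R₁) condition. Then (P, Q) is equivalent to (ξ₁ξ₂, ξ₁ξ₃ + ξ₂²), or to (ξ₁ξ₂, ξ₁² + ξ₃²), or to (ξ₁ξ₂, ξ₁² − ξ₃²). -/

import Mathlib

open MeasureTheory Matrix

noncomputable section

abbrev Mat3 := Matrix (Fin 3) (Fin 3) ℝ

def qf (A : Mat3) (ξ : Fin 3 → ℝ) : ℝ := ξ ⬝ᵥ A *ᵥ ξ

def hess (A : Mat3) : Mat3 := (2:ℝ) • A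

def OmitsVar (A M : Mat3) (j : Fin 3) : Prop :=
  ∀ ξ η : Fin 3 → ℝ, (∀ i, i ≠ j → ξ i = η i) → qf A (M *ᵥ ξ) = qf A (M *ᵥ η)

def IrreduciblePair (A B : Mat3) : Prop :=
  LinearIndependent ℝ ![hess A, hess B] ∧
  ¬ ∃ (M : Mat3) (j : Fin 3), IsUnit M.det ∧ OmitsVar A M j ∧ OmitsVar B M j

/-- The (D) condition: for every nonzero `w`, the polynomial
`ξ ↦ det [∇P(ξ), ∇Q(ξ), w]` does not vanish identically. -/
def DCond (A B : Mat3) : Prop :=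
  ∀ w : Fin 3 → ℝ, w ≠ 0 →
    ∃ ξ : Fin 3 → ℝ,
      (Matrix.of ![(2:ℝ) • (A *ᵥ ξ), (2:ℝ) • (B *ᵥ ξ), w]).det ≠ 0

/-- The (R_{d'}) condition: the minimum over all hyperplanes `H ⊂ ℝ³` (parametrized by
injective linear maps `N : ℝ² → ℝ³`, i.e. `3 × 2` matrices of rank `2`) of the maximum over
`(λ₁, λ₂) ∈ ℝ²` of the rank of the restriction of `λ₁ P + λ₂ Q` to `H` equals `d'`. -/
def RCond (A B : Mat3) (d' : ℕ) : Prop :=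
  (∃ N : Matrix (Fin 3) (Fin 2) ℝ, N.rank = 2 ∧
    ∀ l1 l2 : ℝ, (Nᵀ * (l1 • hess A + l2 • hess B) * N).rank ≤ d') ∧
  (∀ N : Matrix (Fin 3) (Fin 2) ℝ, N.rank = 2 →
    ∃ l1 l2 : ℝ, d' ≤ (Nᵀ * (l1 • hess A + l2 • hess B) * N).rank)

/-- The pair of quadratic forms `(qf A, qf B)` is equivalent to the pair `(p, q)`:
there are invertible matrices `M₁ ∈ GL₃(ℝ)`, `M₂ ∈ GL₂(ℝ)` with
`(p(ξ), q(ξ))ᵀ = M₂ ⬝ (qf A (M₁ ξ), qf B (M₁ ξ))ᵀ` for every `ξ`. -/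
def EquivPair (A B : Mat3) (p q : (Fin 3 → ℝ) → ℝ) : Prop :=
  ∃ (M1 : Mat3) (M2 : Matrix (Fin 2) (Fin 2) ℝ), IsUnit M1.det ∧ IsUnit M2.det ∧
    ∀ ξ : Fin 3 → ℝ,
      p ξ = M2 0 0 * qf A (M1 *ᵥ ξ) + M2 0 1 * qf B (M1 *ᵥ ξ) ∧
      q ξ = M2 1 0 * qf A (M1 *ᵥ ξ) + M2 1 1 * qf B (M1 *ᵥ ξ)


def Goal3 (A B : Mat3) : Prop :=
    EquivPair A B (fun ξ => ξ 0 * ξ 1) (fun ξ => ξ 0 * ξ 2 + ξ 1 ^ 2) ∨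
    EquivPair A B (fun ξ => ξ 0 * ξ 1) (fun ξ => ξ 0 ^ 2 + ξ 2 ^ 2) ∨
    EquivPair A B (fun ξ => ξ 0 * ξ 1) (fun ξ => ξ 0 ^ 2 - ξ 2 ^ 2)

theorem qf_congr (A M : Mat3) (ξ : Fin 3 → ℝ) : qf (Mᵀ * A * M) ξ = qf A (M *ᵥ ξ) := by
  unfold qf
  rw [← Matrix.mulVec_mulVec, ← Matrix.mulVec_mulVec, Matrix.dotProduct_mulVec, Matrix.vecMul_transpose]

theorem qf_lin (A B : Mat3) (x y : ℝ) (ξ : Fin 3 → ℝ) :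
    qf (x • A + y • B) ξ = x * qf A ξ + y * qf B ξ := by
  simp [qf, Matrix.add_mulVec, Matrix.smul_mulVec, dotProduct_add, dotProduct_smul]

theorem equiv_congr (A B M : Mat3) (hM : IsUnit M.det) (p q : (Fin 3 → ℝ) → ℝ)
    (h : EquivPair (Mᵀ * A * M) (Mᵀ * B * M) p q) : EquivPair A B p q := by
  obtain ⟨M1, M2, h1, h2, h3⟩ := h
  refine ⟨M * M1, M2, by rw [Matrix.det_mul]; exact hM.mul h1, h2, fun ξ => ?_⟩
  have := h3 ξ
  simpa only [qf_congr, Matrix.mulVec_mulVec] using this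

theorem equiv_lin (A B : Mat3) (x y z w : ℝ) (hd : x * w - y * z ≠ 0) (p q : (Fin 3 → ℝ) → ℝ)
    (h : EquivPair (x • A + y • B) (z • A + w • B) p q) : EquivPair A B p q := by
  obtain ⟨M1, M2, h1, h2, h3⟩ := h
  refine ⟨M1, M2 * !![x, y; z, w], h1, ?_, fun ξ => ?_⟩
  · rw [Matrix.det_mul]
    refine h2.mul ?_
    rw [Matrix.det_fin_two_of]
    exact hd.isUnit
  · have := h3 ξ
    simp only [qf_lin] at this
    simp only [Matrix.mul_apply, Fin.sum_univ_two]
    simp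
    constructor
    · rw [this.1]; ring
    · rw [this.2]; ring

theorem D_congr (A B M : Mat3) (hM : IsUnit M.det) (h : DCond A B) :
    DCond (Mᵀ * A * M) (Mᵀ * B * M) := by
  intro w hw
  have hMM : M⁻¹ * M = 1 := Matrix.nonsing_inv_mul M hM
  have hMM' : M * M⁻¹ = 1 := Matrix.mul_nonsing_inv M hM
  have hT : w ᵥ* M⁻¹ ≠ 0 := by
    intro h0
    apply hw
    have : (w ᵥ* M⁻¹) ᵥ* M = 0 := by rw [h0]; simp
    rwa [Matrix.vecMul_vecMul, hMM, Matrix.vecMul_one] at this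
  obtain ⟨ξ, hξ⟩ := h (w ᵥ* M⁻¹) hT
  refine ⟨M⁻¹ *ᵥ ξ, ?_⟩
  have key : (Matrix.of ![(2:ℝ) • ((Mᵀ * A * M) *ᵥ (M⁻¹ *ᵥ ξ)), (2:ℝ) • ((Mᵀ * B * M) *ᵥ (M⁻¹ *ᵥ ξ)), w])
     = (Matrix.of ![(2:ℝ) • (A *ᵥ ξ), (2:ℝ) • (B *ᵥ ξ), w ᵥ* M⁻¹]) * M := by
    have e : ∀ C : Mat3, (Mᵀ * C * M) *ᵥ (M⁻¹ *ᵥ ξ) = (C *ᵥ ξ) ᵥ* M := by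
      intro C
      rw [Matrix.mulVec_mulVec, Matrix.mul_assoc, hMM', Matrix.mul_one, ← Matrix.mulVec_mulVec,
        Matrix.mulVec_transpose]
    have e3 : w = (w ᵥ* M⁻¹) ᵥ* M := by rw [Matrix.vecMul_vecMul, hMM, Matrix.vecMul_one]
    rw [e, e]
    ext i j
    rw [Matrix.mul_apply_eq_vecMul]
    fin_cases i
    · exact (congrFun (Matrix.smul_vecMul (2:ℝ) (A *ᵥ ξ) M) j).symm
    · exact (congrFun (Matrix.smul_vecMul (2:ℝ) (B *ᵥ ξ) M) j).symm
    · exact congrFun e3 j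
  rw [key, Matrix.det_mul]
  exact mul_ne_zero hξ hM.ne_zero

theorem D_lin (A B : Mat3) (x y z w : ℝ) (hd : x * w - y * z ≠ 0) (h : DCond A B) :
    DCond (x • A + y • B) (z • A + w • B) := by
  intro v hv
  obtain ⟨ξ, hξ⟩ := h v hv
  refine ⟨ξ, ?_⟩
  have := mul_ne_zero hd hξ
  convert this using 1
  simp only [Matrix.add_mulVec, Matrix.smul_mulVec]
  generalize A *ᵥ ξ = a
  generalize B *ᵥ ξ = b
  simp [Matrix.det_fin_three]
  ring

theorem goal_congr (A B M : Mat3) (hM : M.det ≠ 0) (h : Goal3 (Mᵀ * A * M) (Mᵀ * B * M)) : Goal3 A B := by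
  rcases h with h | h | h
  · exact Or.inl (equiv_congr _ _ _ hM.isUnit _ _ h)
  · exact Or.inr (Or.inl (equiv_congr _ _ _ hM.isUnit _ _ h))
  · exact Or.inr (Or.inr (equiv_congr _ _ _ hM.isUnit _ _ h))

theorem goal_lin (A B : Mat3) (x y z w : ℝ) (hd : x * w - y * z ≠ 0)
    (h : Goal3 (x • A + y • B) (z • A + w • B)) : Goal3 A B := by
  rcases h with h | h | h
  · exact Or.inl (equiv_lin _ _ _ _ _ _ hd _ _ h)
  · exact Or.inr (Or.inl (equiv_lin _ _ _ _ _ _ hd _ _ h))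
  · exact Or.inr (Or.inr (equiv_lin _ _ _ _ _ _ hd _ _ h))

/-- normal form with nonzero (0,1) entry and e = 0 -/
theorem core1 (a b c d f : ℝ) (hb : b ≠ 0)
    (hD : DCond !![a, b, c; b, 0, 0; c, 0, 0] !![d, 0, f; 0, 0, 0; f, 0, 1]) :
    Goal3 !![a, b, c; b, 0, 0; c, 0, 0] !![d, 0, f; 0, 0, 0; f, 0, 1] := by
  have hg : d - f ^ 2 ≠ 0 := by
    intro hg
    obtain ⟨ξ, hξ⟩ := hD ![f, 0, 1] (by intro h; simpa using congrFun h 2)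
    apply hξ
    have : d = f ^ 2 := by linarith
    subst this
    simp [Matrix.det_fin_three, Matrix.mulVec, dotProduct, Fin.sum_univ_three]
    ring
  obtain ⟨s, hs, hs2⟩ : ∃ s : ℝ, s ≠ 0 ∧ (s ^ 2 = d - f ^ 2 ∨ s ^ 2 = - (d - f ^ 2)) := by
    refine ⟨Real.sqrt |d - f ^ 2|, ?_, ?_⟩
    · exact (Real.sqrt_pos.2 (abs_pos.2 hg)).ne'
    · rw [Real.sq_sqrt (abs_nonneg _)]
      exact abs_choice _
  right
  have hdet : IsUnit (!![1, 0, 0; (-a + 2 * c * f) / (2 * b), 1 / (2 * b), - c * s / b; -f, 0, s] : Mat3).det := by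
    apply Ne.isUnit
    simp [Matrix.det_fin_three]
    tauto
  have hdet2 : IsUnit (!![1, 0; 0, 1 / (d - f ^ 2)] : Matrix (Fin 2) (Fin 2) ℝ).det := by
    apply Ne.isUnit
    simp [Matrix.det_fin_two]
    exact hg
  rcases hs2 with hs2 | hs2
  · left
    refine ⟨_, _, hdet, hdet2, fun ξ => ⟨?_, ?_⟩⟩
    · simp [qf, Matrix.mulVec, dotProduct, Fin.sum_univ_three]
      field_simp
      ring
    · simp [qf, Matrix.mulVec, dotProduct, Fin.sum_univ_three]
      field_simp
      linear_combination (- ξ 2 ^ 2) * hs2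
  · right
    refine ⟨_, _, hdet, hdet2, fun ξ => ⟨?_, ?_⟩⟩
    · simp [qf, Matrix.mulVec, dotProduct, Fin.sum_univ_three]
      field_simp
      ring
    · simp [qf, Matrix.mulVec, dotProduct, Fin.sum_univ_three]
      field_simp
      linear_combination (- ξ 2 ^ 2) * hs2

theorem core2 (a c d e f : ℝ)
    (hD : DCond !![a, 0, c; 0, 0, 0; c, 0, 0] !![d, e, f; e, 0, 0; f, 0, 1]) :
    Goal3 !![a, 0, c; 0, 0, 0; c, 0, 0] !![d, e, f; e, 0, 0; f, 0, 1] := by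
  obtain ⟨ξ, hξ⟩ := hD ![1, 0, 0] (by intro h; simpa using congrFun h 0)
  have hc : c ≠ 0 := by
    rintro rfl
    apply hξ
    simp [Matrix.det_fin_three, Matrix.mulVec, dotProduct, Fin.sum_univ_three]
  have he : e ≠ 0 := by
    rintro rfl
    apply hξ
    simp [Matrix.det_fin_three, Matrix.mulVec, dotProduct, Fin.sum_univ_three]
  left
  refine ⟨!![1, 0, 0; (- a ^ 2 / (4 * c ^ 2) - d + f * a / c) / (2 * e), (2 * a / (4 * c ^ 2) - f / c) / (2 * e),
      1 / (4 * c ^ 2) / (2 * e); - a / (2 * c), 1 / (2 * c), 0], !![1, 0; 0, 4 * c ^ 2], ?_, ?_, fun ξ => ⟨?_, ?_⟩⟩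
  · apply Ne.isUnit
    simp [Matrix.det_fin_three]
    tauto
  · apply Ne.isUnit
    simp [Matrix.det_fin_two]
    exact hc
  · simp [qf, Matrix.mulVec, dotProduct, Fin.sum_univ_three]
    field_simp
    ring
  · simp [qf, Matrix.mulVec, dotProduct, Fin.sum_univ_three]
    field_simp
    ring

theorem core3 (a b c d e f : ℝ)
    (hD : DCond !![a, b, c; b, 0, 0; c, 0, 0] !![d, e, f; e, 0, 0; f, 0, 1]) :
    Goal3 !![a, b, c; b, 0, 0; c, 0, 0] !![d, e, f; e, 0, 0; f, 0, 1] := by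
  by_cases hb : b = 0
  · subst hb; exact core2 _ _ _ _ _ hD
  · have hd : (1:ℝ) * 1 - 0 * (-(e / b)) ≠ 0 := by norm_num
    apply goal_lin _ _ 1 0 (-(e / b)) 1 hd
    have hD' := D_lin _ _ 1 0 (-(e / b)) 1 hd hD
    have e1 : (1:ℝ) • (!![a, b, c; b, 0, 0; c, 0, 0] : Mat3) + (0:ℝ) • (!![d, e, f; e, 0, 0; f, 0, 1] : Mat3)
       = !![a, b, c; b, 0, 0; c, 0, 0] := by simp
    have e2 : (-(e / b)) • (!![a, b, c; b, 0, 0; c, 0, 0] : Mat3) + (1:ℝ) • (!![d, e, f; e, 0, 0; f, 0, 1] : Mat3)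
       = !![d - e / b * a, 0, f - e / b * c; 0, 0, 0; f - e / b * c, 0, 1] := by
      ext i j
      fin_cases i <;> fin_cases j <;> simp <;> field_simp <;> ring
    rw [e1, e2] at hD' ⊢
    exact core1 _ _ _ _ _ hb hD'

theorem core4 (A B : Mat3) (hA : A.IsSymm) (hB : B.IsSymm) (hD : DCond A B)
    (h : ∀ l1 l2 : ℝ, (l1 * A 1 1 + l2 * B 1 1) * (l1 * A 2 2 + l2 * B 2 2)
      = (l1 * A 1 2 + l2 * B 1 2) ^ 2) (hr : B 2 2 ≠ 0) : Goal3 A B := by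
  have a10 : A 1 0 = A 0 1 := hA.apply _ _
  have a20 : A 2 0 = A 0 2 := hA.apply _ _
  have a21 : A 2 1 = A 1 2 := hA.apply _ _
  have b10 : B 1 0 = B 0 1 := hB.apply _ _
  have b20 : B 2 0 = B 0 2 := hB.apply _ _
  have b21 : B 2 1 = B 1 2 := hB.apply _ _
  have hM : (!![1, 0, 0; 0, 1, 0; 0, -(B 1 2 / B 2 2), 1] : Mat3).det ≠ 0 := by
    simp [Matrix.det_fin_three]
  apply goal_congr _ _ _ hM
  have hD1 := D_congr _ _ _ hM.isUnit hD
  have hd : (1:ℝ) * (1 / B 2 2) - (- (A 2 2 / B 2 2)) * 0 ≠ 0 := by simpa using hr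
  apply goal_lin _ _ _ _ _ _ hd
  have hD2 := D_lin _ _ _ _ _ _ hd hD1
  have h01 := h 0 1
  have h10 := h 1 0
  have h11 := h 1 1
  set q := B 1 2 with hq
  set r := B 2 2 with hrr
  have hp : B 1 1 = q ^ 2 / r := by field_simp; linarith
  rw [hp] at h11
  have hs : A 1 1 * r ^ 2 - 2 * A 1 2 * q * r + A 2 2 * q ^ 2 = 0 := by
    have : q ^ 2 / r * r = q ^ 2 := by field_simp
    have h2 : A 1 1 * r + q ^ 2 / r * A 2 2 = 2 * A 1 2 * q := by linarith
    field_simp at h2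
    linarith
  have hs2 : A 1 2 * r = A 2 2 * q := by
    have : (A 1 2 * r - A 2 2 * q) ^ 2 = 0 := by
      linear_combination (-r ^ 2) * h10 + A 2 2 * hs
    have := pow_eq_zero_iff (two_ne_zero) |>.1 this
    linarith
  have hA12 : A 1 2 = A 2 2 * q / r := by field_simp; linarith
  have hA11 : A 1 1 = A 2 2 * q ^ 2 / r ^ 2 := by
    rw [hA12] at hs; field_simp at hs ⊢; linarith
  have key : ∀ C : Mat3, C 1 0 = C 0 1 → C 2 0 = C 0 2 → C 2 1 = C 1 2 → C 1 2 = C 2 2 * q / r →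
     C 1 1 = C 2 2 * q ^ 2 / r ^ 2 →
     (!![1, 0, 0; 0, 1, 0; 0, -(q / r), 1] : Mat3)ᵀ * C * (!![1, 0, 0; 0, 1, 0; 0, -(q / r), 1] : Mat3)
      = !![C 0 0, C 0 1 - q / r * C 0 2, C 0 2; C 0 1 - q / r * C 0 2, 0, 0; C 0 2, 0, C 2 2] := by
    intro C h1 h2 h3 h4 h5
    ext i j
    fin_cases i <;> fin_cases j <;> simp [Matrix.mul_apply, Fin.sum_univ_three, h1, h2, h3, h4, h5] <;>
      first | done | (field_simp; done) | (field_simp; ring)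
  rw [key A a10 a20 a21 hA12 hA11, key B b10 b20 b21 (by rw [← hrr, ← hq]; field_simp)
    (by rw [hp, ← hrr]; field_simp)] at hD2 ⊢
  rw [← hrr] at hD2 ⊢
  have e1 : ∀ t0 t1 t2 t u0 u1 u2 : ℝ, (1:ℝ) • (!![t0, t1, t2; t1, 0, 0; t2, 0, t] : Mat3) +
      (-(t / r)) • (!![u0, u1, u2; u1, 0, 0; u2, 0, r] : Mat3)
       = !![t0 - t / r * u0, t1 - t / r * u1, t2 - t / r * u2; t1 - t / r * u1, 0, 0; t2 - t / r * u2, 0, 0] := by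
    intros
    ext i j
    fin_cases i <;> fin_cases j <;> simp [sub_eq_add_neg] <;> field_simp <;> ring
  have e2 : ∀ t0 t1 t2 t u0 u1 u2 : ℝ, (0:ℝ) • (!![t0, t1, t2; t1, 0, 0; t2, 0, t] : Mat3) +
      (1 / r) • (!![u0, u1, u2; u1, 0, 0; u2, 0, r] : Mat3)
       = !![1 / r * u0, 1 / r * u1, 1 / r * u2; 1 / r * u1, 0, 0; 1 / r * u2, 0, 1] := by
    intros
    ext i j
    fin_cases i <;> fin_cases j <;> simp [hr]
  rw [e1, e2] at hD2 ⊢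
  exact core3 _ _ _ _ _ _ hD2

theorem core5 (A B : Mat3) (hA : A.IsSymm) (hB : B.IsSymm) (hD : DCond A B)
    (h : ∀ l1 l2 : ℝ, (l1 * A 1 1 + l2 * B 1 1) * (l1 * A 2 2 + l2 * B 2 2)
      = (l1 * A 1 2 + l2 * B 1 2) ^ 2) (hr : B 1 1 ≠ 0 ∨ B 2 2 ≠ 0) : Goal3 A B := by
  rcases hr with hr | hr
  · have hM : (!![1, 0, 0; 0, 0, 1; 0, 1, 0] : Mat3).det ≠ 0 := by
      simp [Matrix.det_fin_three]
    have a21 : A 2 1 = A 1 2 := hA.apply _ _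
    have b21 : B 2 1 = B 1 2 := hB.apply _ _
    apply goal_congr _ _ _ hM
    apply core4
    · simp [Matrix.IsSymm, Matrix.transpose_mul, Matrix.mul_assoc, hA.eq]
    · simp [Matrix.IsSymm, Matrix.transpose_mul, Matrix.mul_assoc, hB.eq]
    · exact D_congr _ _ _ hM.isUnit hD
    · intro l1 l2
      have := h l1 l2
      simp [Matrix.mul_apply, Fin.sum_univ_three, a21, b21]
      linarith
    · simpa [Matrix.mul_apply, Fin.sum_univ_three] using hr
  · exact core4 A B hA hB hD h hr

theorem classification_D_R1 (A B : Mat3) (hAs : A.IsSymm) (hBs : B.IsSymm)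
    (hirr : IrreduciblePair A B) (hD : DCond A B) (hR : RCond A B 1) :
    EquivPair A B (fun ξ => ξ 0 * ξ 1) (fun ξ => ξ 0 * ξ 2 + ξ 1 ^ 2) ∨
    EquivPair A B (fun ξ => ξ 0 * ξ 1) (fun ξ => ξ 0 ^ 2 + ξ 2 ^ 2) ∨
    EquivPair A B (fun ξ => ξ 0 * ξ 1) (fun ξ => ξ 0 ^ 2 - ξ 2 ^ 2) := by
  change Goal3 A B
  obtain ⟨⟨N, hN, hle⟩, hge⟩ := hR
  obtain ⟨k1, k2, hk⟩ := hge N hN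
  have hdet0 : ∀ l1 l2 : ℝ, (Nᵀ * (l1 • hess A + l2 • hess B) * N).det = 0 := by
    intro l1 l2
    by_contra hne
    have h1 := hle l1 l2
    rw [Matrix.rank_of_isUnit _ ((Matrix.isUnit_iff_isUnit_det _).2 (Ne.isUnit hne))] at h1
    simp at h1
  have hne : Nᵀ * (k1 • hess A + k2 • hess B) * N ≠ 0 := by
    intro h0
    rw [h0] at hk
    simp at hk
  have hli : LinearIndependent ℝ ![N.col 0, N.col 1] := by
    have : LinearIndependent ℝ N.col := by
      rw [linearIndependent_iff_card_eq_finrank_span, Set.finrank, ← Matrix.rank_eq_finrank_span_cols, hN]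
      simp
    convert this using 1
    ext i j
    fin_cases i <;> rfl
  have hcross := crossProduct_ne_zero_iff_linearIndependent.2 hli
  obtain ⟨M, hM, hM1, hM2⟩ : ∃ M : Mat3, M.det ≠ 0 ∧ (∀ i, M i 1 = N i 0) ∧ (∀ i, M i 2 = N i 1) := by
    set v := crossProduct (N.col 0) (N.col 1) with hv
    refine ⟨Matrix.of (fun i => ![v i, N i 0, N i 1]), ?_, fun i => rfl, fun i => rfl⟩
    have : (Matrix.of (fun i => ![v i, N i 0, N i 1])).det = v ⬝ᵥ v := by
      simp [Matrix.det_fin_three, dotProduct, Fin.sum_univ_three, hv, cross_apply]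
      ring
    rw [this]
    exact fun h => hcross (dotProduct_self_eq_zero.1 h)
  have hent : ∀ C : Mat3, ∀ i j : Fin 2, (Mᵀ * C * M) i.succ j.succ = (Nᵀ * C * N) i j := by
    intro C i j
    fin_cases i <;> fin_cases j <;> simp [Matrix.mul_apply, hM1, hM2]
  have symC : ∀ C : Mat3, C.IsSymm → (Mᵀ * C * M).IsSymm := by
    intro C hC
    simp [Matrix.IsSymm, Matrix.transpose_mul, Matrix.mul_assoc, hC.eq]
  have symL : ∀ x y : ℝ, (x • A + y • B).IsSymm := fun x y => (hAs.smul x).add (hBs.smul y)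
  have hk0 : k1 * k1 + k2 * k2 ≠ 0 := by
    intro h0
    have h1 : k1 = 0 := by nlinarith [mul_self_nonneg k1, mul_self_nonneg k2]
    have h2 : k2 = 0 := by nlinarith [mul_self_nonneg k1, mul_self_nonneg k2]
    apply hne
    simp [h1, h2]
  have hd : k2 * k2 - (-k1) * k1 ≠ 0 := by
    intro h; apply hk0; linarith
  apply goal_lin _ _ _ _ _ _ hd
  apply goal_congr _ _ _ hM
  have hdet1 : ∀ x y : ℝ, (Nᵀ * (x • A + y • B) * N) 0 0 * (Nᵀ * (x • A + y • B) * N) 1 1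
      = (Nᵀ * (x • A + y • B) * N) 0 1 ^ 2 := by
    intro x y
    have := hdet0 (x / 2) (y / 2)
    have e : (x / 2) • hess A + (y / 2) • hess B = x • A + y • B := by
      simp [hess, smul_smul]
    rw [e, Matrix.det_fin_two] at this
    have hs : (Nᵀ * (x • A + y • B) * N) 1 0 = (Nᵀ * (x • A + y • B) * N) 0 1 := by
      have h1 := (symC _ (symL x y)).apply 1 2
      have h2 := hent (x • A + y • B) 1 0
      have h3 := hent (x • A + y • B) 0 1
      exact h2.symm.trans (h1.trans h3)
    rw [hs] at this
    linarith
  have hsum : ∀ (l1 l2 : ℝ) (C E : Mat3) (i j : Fin 3), l1 * (Mᵀ * C * M) i j + l2 * (Mᵀ * E * M) i j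
      = (Mᵀ * (l1 • C + l2 • E) * M) i j := by
    intro l1 l2 C E i j
    simp [Matrix.mul_add, Matrix.add_mul]
  apply core5
  · exact symC _ (symL _ _)
  · exact symC _ (symL _ _)
  · exact D_congr _ _ _ hM.isUnit (D_lin _ _ _ _ _ _ hd hD)
  · intro l1 l2
    simp only [hsum]
    have e : l1 • (k2 • A + (-k1) • B) + l2 • (k1 • A + k2 • B)
      = (l1 * k2 + l2 * k1) • A + (l1 * (-k1) + l2 * k2) • B := by
      module
    rw [e]
    have := hdet1 (l1 * k2 + l2 * k1) (l1 * (-k1) + l2 * k2)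
    rw [← hent, ← hent, ← hent] at this
    exact this
  · by_contra hcon
    push Not at hcon
    obtain ⟨h1, h2⟩ := hcon
    have g1 := (hent (k1 • A + k2 • B) 0 0).symm.trans h1
    have g2 := (hent (k1 • A + k2 • B) 1 1).symm.trans h2
    have g3 := hdet1 k1 k2
    rw [g1] at g3
    have g4 : (Nᵀ * (k1 • A + k2 • B) * N) 0 1 = 0 := by
      apply pow_eq_zero_iff (two_ne_zero) |>.1
      rw [← g3]; ring
    have g5 : (Nᵀ * (k1 • A + k2 • B) * N) 1 0 = 0 := by
      have h1 := (symC _ (symL k1 k2)).apply 1 2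
      have h2 := hent (k1 • A + k2 • B) 1 0
      have h3 := hent (k1 • A + k2 • B) 0 1
      exact (h2.symm.trans (h1.trans h3)).trans g4
    apply hne
    have e : k1 • hess A + k2 • hess B = (2:ℝ) • (k1 • A + k2 • B) := by
      simp only [hess]; module
    rw [e, Matrix.mul_smul, Matrix.smul_mul]
    have : Nᵀ * (k1 • A + k2 • B) * N = 0 := by
      ext i j
      fin_cases i <;> fin_cases j
      · exact g1
      · exact g4
      · exact g5
      · exact g2
    rw [this, smul_zero]
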